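/- arXiv:1806.06726 — 5 statements merged into one kernel-verified Lean document; each statement's English description precedes it below -/
import Mathlib

section
/- If two binary search trees both satisfy the zip tree rank-ordering condition and contain exactly the same finite set of (key, rank)-labelled nodes, where all keys are distinct, then the two trees are identical (the structure of a zip tree is uniquely determined by the keys and ranks of its nodes). -/
open scoped ENNReal

/-- A binary tree whose nodes carry a key of type `α` and a natural-number rank. -/
inductive ZTree (α : Type) : Type where
  | leaf : ZTree α
  | node (left : ZTree α) (key : α) (rank : ℕ) (right : ZTree α) : ZTree α

namespace ZTree
variable {α : Type} [LinearOrder α]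

/-- The list of (key, rank) pairs of the nodes of the tree, in symmetric order. -/
def nodes : ZTree α → List (α × ℕ)
  | .leaf => []
  | .node l k rk r => l.nodes ++ (k, rk) :: r.nodes

/-- Binary-search-tree (symmetric order) property. -/
def isBST : ZTree α → Prop
  | .leaf => True
  | .node l k _ r =>
      (∀ p ∈ l.nodes, p.1 < k) ∧ (∀ p ∈ r.nodes, k < p.1) ∧ l.isBST ∧ r.isBST

/-- The rank of the root node, if any. -/
def rootRank? : ZTree α → Option ℕ
  | .leaf => none
  | .node _ _ rk _ => some rk

/-- Max-heap order on ranks, ties broken in favor of smaller keys: every node's rank is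
strictly greater than that of its left child and at least that of its right child. -/
def isRankHeap : ZTree α → Prop
  | .leaf => True
  | .node l _ rk r =>
      (∀ m ∈ l.rootRank?, m < rk) ∧ (∀ m ∈ r.rootRank?, m ≤ rk) ∧
        l.isRankHeap ∧ r.isRankHeap

/-- The zip-tree conditions: symmetric order on keys and heap order on ranks. -/
def isZipTree (t : ZTree α) : Prop := t.isBST ∧ t.isRankHeap

/-- The (key, rank) pairs on the search path from the root to the node with key `a`. -/
def pathTo (a : α) : ZTree α → List (α × ℕ)
  | .leaf => []
  | .node l k rk r =>
      if a < k then (k, rk) :: l.pathTo a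
      else if k < a then (k, rk) :: r.pathTo a
      else [(k, rk)]

/-- The depth (number of edges from the root) of the node with key `a`. -/
def depth (a : α) : ZTree α → ℕ
  | .leaf => 0
  | .node l k _ r =>
      if a < k then l.depth a + 1
      else if k < a then r.depth a + 1
      else 0

/-- The subtree rooted at the node with key `a`. -/
def subtreeAt (a : α) : ZTree α → ZTree α
  | .leaf => .leaf
  | .node l k rk r =>
      if a < k then l.subtreeAt a
      else if k < a then r.subtreeAt a
      else .node l k rk r

/-- Number of nodes on the left spine (root through left children). -/
def leftSpineLen : ZTree α → ℕ
  | .leaf => 0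
  | .node l _ _ _ => l.leftSpineLen + 1

/-- Number of nodes on the right spine (root through right children). -/
def rightSpineLen : ZTree α → ℕ
  | .leaf => 0
  | .node _ _ _ r => r.rightSpineLen + 1

/-- Total number of nodes on the right spine of the left subtree of the node with key `a`
together with the left spine of its right subtree: the paths zipped when deleting this
node, equivalently, the path unzipped when inserting it. -/
def zipSpineCount (a : α) (t : ZTree α) : ℕ :=
  match t.subtreeAt a with
  | .leaf => 0
  | .node l _ _ r => l.rightSpineLen + r.leftSpineLen

end ZTree

namespace ZTree

theorem isRankHeap.rank_le_rootRank {α : Type} {t : ZTree α} (h : t.isRankHeap) :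
    ∀ p ∈ t.nodes, ∀ m ∈ t.rootRank?, p.2 ≤ m := by
  induction t with
  | leaf => simp [nodes]
  | node l k rk r ihl ihr =>
    obtain ⟨hl, hr, hhl, hhr⟩ := h
    intro p hp m hm
    obtain rfl : rk = m := by simpa [rootRank?] using hm
    simp only [nodes, List.mem_append, List.mem_cons] at hp
    rcases hp with hp | rfl | hp
    · cases l with
      | leaf => simp [nodes] at hp
      | node _ _ rl _ => exact (ihl hhl p hp rl rfl).trans (hl rl rfl).le
    · exact le_rfl
    · cases r with
      | leaf => simp [nodes] at hp
      | node _ _ rr _ => exact (ihr hhr p hp rr rfl).trans (hr rr rfl)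

theorem isRankHeap.rank_lt_of_mem_left {α : Type} {l r : ZTree α} {k : α} {rk : ℕ}
    (h : (node l k rk r).isRankHeap) : ∀ p ∈ l.nodes, p.2 < rk := by
  obtain ⟨hl, -, hhl, -⟩ := h
  intro p hp
  cases l with
  | leaf => simp [nodes] at hp
  | node _ _ rl _ => exact (hhl.rank_le_rootRank p hp rl rfl).trans_lt (hl rl rfl)

/-- The root of a zip tree has maximum rank, and the smallest key among the nodes of that rank. -/
theorem isZipTree.root_key_le {α : Type} [LinearOrder α] {l r : ZTree α} {k : α} {rk : ℕ}
    (h : (node l k rk r).isZipTree) {p : α × ℕ} (hp : p ∈ (node l k rk r).nodes)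
    (hrk : rk ≤ p.2) : k ≤ p.1 := by
  simp only [nodes, List.mem_append, List.mem_cons] at hp
  rcases hp with hp | rfl | hp
  · exact absurd (h.2.rank_lt_of_mem_left p hp) hrk.not_gt
  · exact le_rfl
  · exact (h.1.2.1 p hp).le

theorem isBST.mem_left_iff {α : Type} [LinearOrder α] {l r : ZTree α} {k : α} {rk : ℕ}
    (h : (node l k rk r).isBST) (p : α × ℕ) :
    p ∈ l.nodes ↔ p ∈ (node l k rk r).nodes ∧ p.1 < k := by
  simp only [nodes, List.mem_append, List.mem_cons]
  refine ⟨fun hp => ⟨.inl hp, h.1 p hp⟩, ?_⟩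
  rintro ⟨hp | rfl | hp, hlt⟩
  · exact hp
  · exact absurd hlt (lt_irrefl _)
  · exact absurd hlt (h.2.1 p hp).not_gt

theorem isBST.mem_right_iff {α : Type} [LinearOrder α] {l r : ZTree α} {k : α} {rk : ℕ}
    (h : (node l k rk r).isBST) (p : α × ℕ) :
    p ∈ r.nodes ↔ p ∈ (node l k rk r).nodes ∧ k < p.1 := by
  simp only [nodes, List.mem_append, List.mem_cons]
  refine ⟨fun hp => ⟨.inr (.inr hp), h.2.1 p hp⟩, ?_⟩
  rintro ⟨hp | rfl | hp, hlt⟩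
  · exact absurd hlt (h.1 p hp).not_gt
  · exact absurd hlt (lt_irrefl _)
  · exact hp

theorem isZipTree.eq_of_mem_nodes_iff {α : Type} [LinearOrder α] {s t : ZTree α}
    (hs : s.isZipTree) (ht : t.isZipTree) (hst : ∀ p : α × ℕ, p ∈ s.nodes ↔ p ∈ t.nodes) :
    s = t := by
  induction s generalizing t with
  | leaf =>
    cases t with
    | leaf => rfl
    | node l k rk r => simpa [nodes] using hst (k, rk)
  | node l k rk r ihl ihr =>
    cases t with
    | leaf => simpa [nodes] using hst (k, rk)
    | node l' k' rk' r' =>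
      have hmem : (k, rk) ∈ (node l' k' rk' r').nodes := (hst _).1 (by simp [nodes])
      have hmem' : (k', rk') ∈ (node l k rk r).nodes := (hst _).2 (by simp [nodes])
      obtain rfl : rk = rk' :=
        le_antisymm (ht.2.rank_le_rootRank _ hmem _ rfl) (hs.2.rank_le_rootRank _ hmem' _ rfl)
      obtain rfl : k = k' :=
        le_antisymm (hs.root_key_le hmem' le_rfl) (ht.root_key_le hmem le_rfl)
      have hl : l = l' := ihl ⟨hs.1.2.2.1, hs.2.2.2.1⟩ ⟨ht.1.2.2.1, ht.2.2.2.1⟩ fun p => by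
        rw [hs.1.mem_left_iff, ht.1.mem_left_iff, hst]
      have hr : r = r' := ihr ⟨hs.1.2.2.2, hs.2.2.2.2⟩ ⟨ht.1.2.2.2, ht.2.2.2.2⟩ fun p => by
        rw [hs.1.mem_right_iff, ht.1.mem_right_iff, hst]
      rw [hl, hr]

end ZTree

/-- **Uniqueness of zip trees (Lemma 1).** If two binary search trees both satisfy the
zip-tree rank-ordering condition and contain exactly the same finite set of
(key, rank)-labelled nodes, where all keys are distinct, then the two trees are
identical. -/
theorem zipTree_unique {α : Type} [LinearOrder α] (T₁ T₂ : ZTree α)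
    (h₁ : T₁.isZipTree) (h₂ : T₂.isZipTree)
    (hd₁ : (T₁.nodes.map Prod.fst).Nodup)
    (hd₂ : (T₂.nodes.map Prod.fst).Nodup)
    (hsame : ∀ p : α × ℕ, p ∈ T₁.nodes ↔ p ∈ T₂.nodes) :
    T₁ = T₂ := by
  exact h₁.eq_of_mem_nodes_iff h₂ hsame
end

section
/- Let R_0, …, R_{n-1} be independent random variables, each geometrically distributed on the natural numbers with P(R_i = k) = 1/2^{k+1}. If n ≥ 2, then the expected value of max_{0 ≤ i < n} R_i is at most lg n + 3. -/
open scoped ENNReal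

/-- Fubini for finite products of series: the sum over `Fin n → ℕ` of a product of functions of the
coordinates is the product of the sums. -/
theorem ENNReal.tsum_fin_pi_prod {α : Type*} (n : ℕ) (h : Fin n → α → ℝ≥0∞) :
    ∑' f : Fin n → α, ∏ j, h j (f j) = ∏ j, ∑' k, h j k := by
  induction n with
  | zero => simp
  | succ n ih =>
    rw [Fin.prod_univ_succ, ← ih fun j => h j.succ,
      ← (Fin.consEquiv fun _ : Fin (n + 1) => α).tsum_eq, ENNReal.tsum_prod',
      ← ENNReal.tsum_mul_right]
    refine tsum_congr fun a => ?_
    rw [← ENNReal.tsum_mul_left]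
    refine tsum_congr fun f => ?_
    simp [Fin.consEquiv, Fin.prod_univ_succ]

/-- A geometric random variable with success probability `1/2` has total mass `1`. -/
theorem tsum_half_pow_succ : ∑' k : ℕ, (1 / 2 : ℝ≥0∞) ^ (k + 1) = 1 := by
  rw [ENNReal.tsum_geometric_add_one, one_div, ENNReal.one_sub_inv_two, inv_inv]
  exact ENNReal.inv_mul_cancel (by norm_num) (by norm_num)

/-- A geometric random variable with success probability `1/2` has mean `1`. -/
theorem tsum_half_pow_succ_mul : ∑' k : ℕ, (1 / 2 : ℝ≥0∞) ^ (k + 1) * (k : ℝ≥0∞) = 1 := by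
  have h := hasSum_coe_mul_geometric_of_norm_lt_one (r := (1 / 2 : ℝ)) (by norm_num)
  have h' := h.mul_left (1 / 2 : ℝ)
  have e := ENNReal.ofReal_tsum_of_nonneg (fun k : ℕ => by positivity) h'.summable
  rw [h'.tsum_eq] at e
  have half : ENNReal.ofReal (1 / 2) = 1 / 2 := by
    rw [ENNReal.ofReal_div_of_pos (by norm_num), ENNReal.ofReal_one, ENNReal.ofReal_ofNat]
  calc ∑' k : ℕ, (1 / 2 : ℝ≥0∞) ^ (k + 1) * (k : ℝ≥0∞)
      = ∑' k : ℕ, ENNReal.ofReal (1 / 2 * (k * (1 / 2) ^ k)) := by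
        refine tsum_congr fun k => ?_
        rw [ENNReal.ofReal_mul (by norm_num), ENNReal.ofReal_mul (by positivity),
          ENNReal.ofReal_pow (by norm_num), ENNReal.ofReal_natCast, half, pow_succ]
        ac_rfl
    _ = 1 := by rw [← e]; norm_num

/-- The expected excess over `m` of a geometric random variable is `2⁻ᵐ`. -/
theorem tsum_half_pow_succ_mul_sub (m : ℕ) :
    ∑' k : ℕ, (1 / 2 : ℝ≥0∞) ^ (k + 1) * ((k - m : ℕ) : ℝ≥0∞) = (1 / 2) ^ m := by
  induction m with
  | zero => simpa using tsum_half_pow_succ_mul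
  | succ m ih =>
    rw [tsum_eq_zero_add' ENNReal.summable, pow_succ' _ m, ← ih, ← ENNReal.tsum_mul_left]
    simp only [Nat.zero_sub, Nat.cast_zero, mul_zero, zero_add, Nat.add_sub_add_right]
    refine tsum_congr fun k => ?_
    ring

/-- The law of a single coordinate under a product of geometric distributions. -/
theorem tsum_geometric_pi_mul_apply {n : ℕ} (i : Fin n) (g : ℕ → ℝ≥0∞) :
    ∑' f : Fin n → ℕ, (∏ j, (1 / 2 : ℝ≥0∞) ^ (f j + 1)) * g (f i) =
      ∑' k : ℕ, (1 / 2 : ℝ≥0∞) ^ (k + 1) * g k := by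
  have h := ENNReal.tsum_fin_pi_prod n fun j k =>
    (1 / 2 : ℝ≥0∞) ^ (k + 1) * if j = i then g k else 1
  rw [Finset.prod_eq_single i (fun j _ hj => by simpa [hj] using tsum_half_pow_succ)
    (by simp)] at h
  simpa only [Finset.prod_mul_distrib, Finset.prod_ite_eq', Finset.mem_univ, if_true] using h

/-- **Expected root rank.** If `R_0, …, R_{n-1}` are independent geometric random
variables with `P(R_i = k) = 1/2^(k+1)` (modelled by the product PMF `μ` on
`Fin n → ℕ`) and `n ≥ 2`, then the expected value of `max_i R_i` is at most
`lg n + 3`. -/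
theorem expected_max_rank (n : ℕ) (hn : 2 ≤ n)
    (μ : PMF (Fin n → ℕ))
    (hμ : ∀ f : Fin n → ℕ, μ f = ∏ j : Fin n, (1 / 2 : ℝ≥0∞) ^ (f j + 1)) :
    ∑' f : Fin n → ℕ, μ f * ((Finset.univ.sup f : ℕ) : ℝ≥0∞) ≤
      ENNReal.ofReal (Real.logb 2 n + 3) := by
  set m := Nat.log 2 n + 1 with hm
  have hnm : n ≤ 2 ^ m := (Nat.lt_pow_succ_log_self (by norm_num) n).le
  have hlog : (m : ℝ) ≤ Real.logb 2 n + 1 := by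
    have := Real.natLog_le_logb n 2
    push_cast [hm] at this ⊢
    linarith
  have hsup (f : Fin n → ℕ) : Finset.univ.sup f ≤ m + ∑ j, (f j - m) := by
    refine Finset.sup_le fun i _ => ?_
    have := Finset.single_le_sum (f := fun j => f j - m) (fun _ _ => Nat.zero_le _)
      (Finset.mem_univ i)
    omega
  have hexcess : ∑' f : Fin n → ℕ, μ f * ∑ j, ((f j - m : ℕ) : ℝ≥0∞) ≤ 1 := by
    simp_rw [Finset.mul_sum, hμ]
    rw [Summable.tsum_finsetSum fun _ _ => ENNReal.summable]
    simp_rw [tsum_geometric_pi_mul_apply _ fun k => ((k - m : ℕ) : ℝ≥0∞),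
      tsum_half_pow_succ_mul_sub]
    rw [Finset.sum_const, Finset.card_univ, Fintype.card_fin, nsmul_eq_mul, one_div,
      ← ENNReal.inv_pow, ← div_eq_mul_inv]
    exact ENNReal.div_le_of_le_mul (by rw [one_mul]; exact_mod_cast hnm)
  calc ∑' f : Fin n → ℕ, μ f * ((Finset.univ.sup f : ℕ) : ℝ≥0∞)
      ≤ ∑' f : Fin n → ℕ, (μ f * m + μ f * ∑ j, ((f j - m : ℕ) : ℝ≥0∞)) := by
        refine ENNReal.tsum_le_tsum fun f => ?_
        rw [← mul_add]
        gcongr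
        exact_mod_cast hsup f
    _ ≤ m + 1 := by
        rw [ENNReal.tsum_add, ENNReal.tsum_mul_right, μ.tsum_coe, one_mul]
        gcongr
    _ = ENNReal.ofReal (m + 1) := by
        rw [ENNReal.ofReal_add (by positivity) (by norm_num), ENNReal.ofReal_natCast,
          ENNReal.ofReal_one]
    _ ≤ ENNReal.ofReal (Real.logb 2 n + 3) := ENNReal.ofReal_le_ofReal (by linarith)
end

section
/- Let T be a zip tree on a finite set of nodes with distinct keys, let x be a node of T, and let y be a node of T with key(y) ≤ key(x). Then y is an ancestor of x (where every node is an ancestor of itself) if and only if rank(y) ≥ rank(z) for every node z of T with key(y) ≤ key(z) ≤ key(x). -/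
open scoped ENNReal

namespace ZTree
variable {α : Type}

theorem exists_rootRank_ge {t : ZTree α} (ht : t.isRankHeap) {p : α × ℕ} (hp : p ∈ t.nodes) :
    ∃ m ∈ t.rootRank?, p.2 ≤ m := by
  induction t with
  | leaf => simp [nodes] at hp
  | node l k rk r ihl ihr =>
    obtain ⟨hl, hr, htl, htr⟩ := ht
    refine ⟨rk, rfl, ?_⟩
    simp only [nodes, List.mem_append, List.mem_cons] at hp
    rcases hp with hp | rfl | hp
    · obtain ⟨m, hm, hpm⟩ := ihl htl hp
      exact hpm.trans (hl m hm).le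
    · exact le_rfl
    · obtain ⟨m, hm, hpm⟩ := ihr htr hp
      exact hpm.trans (hr m hm)

variable [LinearOrder α]

theorem mem_nodes_of_mem_pathTo {t : ZTree α} {a : α} {p : α × ℕ} (hp : p ∈ t.pathTo a) :
    p ∈ t.nodes := by
  induction t with
  | leaf => simp [pathTo] at hp
  | node l k rk r ihl ihr =>
    simp only [pathTo] at hp
    simp only [nodes, List.mem_append, List.mem_cons]
    split_ifs at hp <;> grind

theorem mem_pathTo_iff {t : ZTree α} (ht : t.isZipTree) {x y : α × ℕ} (hx : x ∈ t.nodes)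
    (hy : y ∈ t.nodes) (hkey : y.1 ≤ x.1) :
    y ∈ t.pathTo x.1 ↔ ∀ z ∈ t.nodes, y.1 ≤ z.1 → z.1 ≤ x.1 → z.2 ≤ y.2 := by
  induction t with
  | leaf => simp [nodes] at hx
  | node l k rk r ihl ihr =>
    obtain ⟨⟨hlk, hrk, hbl, hbr⟩, hl, hr, htl, htr⟩ := ht
    have rank_left : ∀ p ∈ l.nodes, p.2 < rk := fun p hp =>
      let ⟨m, hm, hpm⟩ := exists_rootRank_ge htl hp
      hpm.trans_lt (hl m hm)
    have rank_right : ∀ p ∈ r.nodes, p.2 ≤ rk := fun p hp =>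
      let ⟨m, hm, hpm⟩ := exists_rootRank_ge htr hp
      hpm.trans (hr m hm)
    have path_right : ∀ p ∈ r.pathTo x.1, p ∈ r.nodes := fun p => mem_nodes_of_mem_pathTo
    replace ihl := ihl ⟨hbl, htl⟩
    replace ihr := ihr ⟨hbr, htr⟩
    simp only [nodes, List.mem_append, List.mem_cons] at hx hy ⊢
    simp only [pathTo]
    split_ifs with hxk hkx
    · have hxl : x ∈ l.nodes := by grind
      have hyl : y ∈ l.nodes := by grind
      have hyk : y ≠ (k, rk) := by grind
      rw [List.mem_cons, or_iff_right hyk, ihl hxl hyl]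
      grind
    · have hxr : x ∈ r.nodes := by grind
      rcases hy with hy | rfl | hy
      · have := hlk y hy
        exact iff_of_false (by grind) fun h =>
          (rank_left y hy).not_ge (h (k, rk) (by simp) this.le hkx.le)
      · grind
      · have hyk : y ≠ (k, rk) := by grind
        rw [List.mem_cons, or_iff_right hyk, ihr hxr hy]
        grind
    · have hxk : x.1 = k := le_antisymm (not_lt.1 hkx) (not_lt.1 hxk)
      rcases hy with hy | rfl | hy
      · have := hlk y hy
        exact iff_of_false (by grind) fun h =>
          (rank_left y hy).not_ge (h (k, rk) (by simp) this.le hxk.ge)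
      · grind
      · grind

end ZTree

/-- **Characterization of low ancestors.** Let `T` be a zip tree with distinct keys,
let `x` be a node of `T`, and let `y` be a node of `T` with `key y ≤ key x`. Then `y`
is an ancestor of `x` (i.e. `y` lies on the search path from the root to `x`, where
every node is an ancestor of itself) if and only if `rank y ≥ rank z` for every node
`z` of `T` with `key y ≤ key z ≤ key x`. -/
theorem low_ancestor_iff {α : Type} [LinearOrder α] (T : ZTree α)
    (hT : T.isZipTree) (hd : (T.nodes.map Prod.fst).Nodup)
    (x y : α × ℕ) (hx : x ∈ T.nodes) (hy : y ∈ T.nodes) (hkey : y.1 ≤ x.1) :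
    y ∈ T.pathTo x.1 ↔ ∀ z ∈ T.nodes, y.1 ≤ z.1 → z.1 ≤ x.1 → z.2 ≤ y.2 := by
  exact ZTree.mem_pathTo_iff hT hx hy hkey
end

section
/- There exists a constant a > 0, independent of n and c, such that the following holds: for every n ≥ 2 and every real c ≥ 1, if r : Fin n → ℕ is a family of independent geometric random variables with P(r(i) = k) = 1/2^{k+1} and T(r) is the (unique) zip tree on nodes with keys 0, …, n−1 and ranks r, then the probability that some node of T(r) has depth exceeding a·c·lg n is at most 1/n^c. -/
open scoped ENNReal

namespace ZTree

/-- The number of weak left-to-right records of a list that are at least `m`. -/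
def recordCount : ℕ → List ℕ → ℕ
  | _, [] => 0
  | m, x :: xs => if m ≤ x then recordCount x xs + 1 else recordCount m xs

/-- A supermartingale potential: each weak record contributes a factor `3 / 2`, and the final
maximum `M` contributes `2⁻¹ ^ M`. -/
noncomputable def recordPotential : ℕ → List ℕ → ℝ≥0∞
  | m, [] => 2⁻¹ ^ m
  | m, x :: xs => if m ≤ x then 3 / 2 * recordPotential x xs else recordPotential m xs

lemma recordCount_le_append (m : ℕ) (l l' : List ℕ) :
    recordCount m l ≤ recordCount m (l ++ l') := by
  induction l generalizing m with
  | nil => simp [recordCount]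
  | cons x xs ih =>
    simp only [List.cons_append, recordCount]
    split_ifs
    · exact Nat.succ_le_succ (ih x)
    · exact ih m

lemma recordCount_succ_le_append (m x : ℕ) (l l' : List ℕ) (hm : m ≤ x)
    (hl : ∀ y ∈ l, y ≤ x) :
    recordCount m l + 1 ≤ recordCount m (l ++ x :: l') := by
  induction l generalizing m with
  | nil => simp [recordCount, hm]
  | cons y ys ih =>
    simp only [List.mem_cons, forall_eq_or_imp] at hl
    simp only [List.cons_append, recordCount]
    split_ifs
    · exact Nat.succ_le_succ (ih y hl.1 hl.2)
    · exact ih m hm hl.2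

lemma le_recordPotential (M m : ℕ) (l : List ℕ) (hm : m ≤ M) (hl : ∀ y ∈ l, y ≤ M) :
    (3 / 2) ^ recordCount m l * 2⁻¹ ^ M ≤ recordPotential m l := by
  induction l generalizing m with
  | nil =>
    simp only [recordCount, recordPotential, pow_zero, one_mul]
    exact pow_le_pow_of_le_one (by simp) (by simp) hm
  | cons x xs ih =>
    simp only [List.mem_cons, forall_eq_or_imp] at hl
    simp only [recordCount, recordPotential]
    split_ifs
    · rw [pow_succ', mul_assoc]
      gcongr
      exact ih x hl.1 hl.2
    · exact ih m hm hl.2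

/-! ### Ancestors in a zip tree are records -/

lemma isRankHeap.rank_le {α : Type} [LinearOrder α] {t : ZTree α} (h : t.isRankHeap) {b : ℕ}
    (hb : ∀ m ∈ t.rootRank?, m ≤ b) : ∀ p ∈ t.nodes, p.2 ≤ b := by
  induction t generalizing b with
  | leaf => simp [nodes]
  | node l k rk r ihl ihr =>
    obtain ⟨h1, h2, h3, h4⟩ := h
    have hrk : rk ≤ b := hb rk rfl
    intro p hp
    simp only [nodes, List.mem_append, List.mem_cons] at hp
    rcases hp with hp | rfl | hp
    · exact (ihl h3 (fun m hm => (h1 m hm).le) p hp).trans hrk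
    · exact hrk
    · exact (ihr h4 h2 p hp).trans hrk

lemma isBST.pairwise_nodes {α : Type} [LinearOrder α] {t : ZTree α} (h : t.isBST) :
    t.nodes.Pairwise (fun p q => p.1 < q.1) := by
  induction t with
  | leaf => simp [nodes]
  | node l k rk r ihl ihr =>
    obtain ⟨h1, h2, h3, h4⟩ := h
    simp only [nodes, List.pairwise_append, List.pairwise_cons, List.mem_cons]
    refine ⟨ihl h3, ⟨h2, ihr h4⟩, ?_⟩
    rintro p hp q (rfl | hq)
    · exact h1 p hp
    · exact (h1 p hp).trans (h2 q hq)

lemma depth_le_recordCount {α : Type} [LinearOrder α] {t : ZTree α} (h : t.isZipTree) (a : α) :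
    t.depth a ≤ recordCount 0 ((t.nodes.filter (fun p => a ≤ p.1)).map Prod.snd) +
      recordCount 0 ((t.nodes.reverse.filter (fun p => p.1 ≤ a)).map Prod.snd) := by
  induction t with
  | leaf => simp [depth]
  | node l k rk r ihl ihr =>
    obtain ⟨⟨h1, h2, h3, h4⟩, h5, h6, h7, h8⟩ := h
    have hl := h7.rank_le (fun m hm => (h5 m hm).le)
    have hr := h8.rank_le h6
    simp only [depth, nodes]
    split_ifs with hak hka
    · have e : ((l.nodes ++ (k, rk) :: r.nodes).reverse.filter (fun p => p.1 ≤ a)) =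
          l.nodes.reverse.filter (fun p => p.1 ≤ a) := by
        have : r.nodes.reverse.filter (fun p => p.1 ≤ a) = [] := by
          simp only [List.filter_eq_nil_iff, List.mem_reverse, decide_eq_true_eq, not_le]
          exact fun p hp => hak.trans (h2 p hp)
        simp [this, hak]
      rw [e]
      have := recordCount_succ_le_append 0 rk
        ((l.nodes.filter (fun p => a ≤ p.1)).map Prod.snd)
        ((r.nodes.filter (fun p => a ≤ p.1)).map Prod.snd) (Nat.zero_le _) (by
          intro y hy
          simp only [List.mem_map, List.mem_filter] at hy
          obtain ⟨p, hp, rfl⟩ := hy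
          exact hl p hp.1)
      have ih := ihl ⟨h3, h7⟩
      simp only [List.filter_append, List.filter_cons, hak.le, decide_true, if_true,
        List.map_append, List.map_cons]
      omega
    · have e : ((l.nodes ++ (k, rk) :: r.nodes).filter (fun p => a ≤ p.1)) =
          r.nodes.filter (fun p => a ≤ p.1) := by
        have : l.nodes.filter (fun p => a ≤ p.1) = [] := by
          simp only [List.filter_eq_nil_iff, decide_eq_true_eq, not_le]
          exact fun p hp => (h1 p hp).trans hka
        simp [this, hka]
      rw [e]
      have := recordCount_succ_le_append 0 rk
        ((r.nodes.reverse.filter (fun p => p.1 ≤ a)).map Prod.snd)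
        ((l.nodes.reverse.filter (fun p => p.1 ≤ a)).map Prod.snd) (Nat.zero_le _) (by
          intro y hy
          simp only [List.mem_map, List.mem_filter, List.mem_reverse] at hy
          obtain ⟨p, hp, rfl⟩ := hy
          exact hr p hp.1)
      have ih := ihr ⟨h4, h8⟩
      simp only [List.reverse_append, List.reverse_cons, List.append_assoc, List.singleton_append,
        List.filter_append, List.filter_cons, hka.le, decide_true, if_true,
        List.map_append, List.map_cons]
      omega
    · exact Nat.zero_le _

lemma isBST.nodes_eq {n : ℕ} {t : ZTree ℕ} (h : t.isBST) (f : Fin n → ℕ)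
    (hp : t.nodes.Perm ((List.finRange n).map fun j : Fin n => ((j : ℕ), f j))) :
    t.nodes = (List.finRange n).map fun j : Fin n => ((j : ℕ), f j) := by
  refine hp.eq_of_pairwise (le := fun p q => p.1 < q.1) (fun a b _ _ h1 h2 => ?_)
    h.pairwise_nodes ?_
  · exact absurd h1 h2.asymm
  · rw [List.pairwise_map]
    exact List.pairwise_lt_finRange n

/-! ### Expectations under independent geometric ranks -/

/-- The expectation of `F` under `n` independent geometric random variables of mean `1`. -/
noncomputable def geomExp (n : ℕ) (F : (Fin n → ℕ) → ℝ≥0∞) : ℝ≥0∞ :=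
  ∑' f : Fin n → ℕ, (∏ j, (1 / 2 : ℝ≥0∞) ^ (f j + 1)) * F f

lemma geomExp_zero (F : (Fin 0 → ℕ) → ℝ≥0∞) : geomExp 0 F = F ![] := by
  rw [geomExp, tsum_eq_single ![] (fun b hb => absurd (Subsingleton.elim _ _) hb)]
  simp

lemma geomExp_succ (n : ℕ) (F : (Fin (n + 1) → ℕ) → ℝ≥0∞) :
    geomExp (n + 1) F =
      ∑' x : ℕ, (1 / 2 : ℝ≥0∞) ^ (x + 1) * geomExp n (fun f => F (Fin.cons x f)) := by
  simp only [geomExp]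
  rw [← (Fin.consEquiv (fun _ : Fin (n + 1) => ℕ)).tsum_eq, ENNReal.tsum_prod']
  refine tsum_congr fun x => ?_
  rw [← ENNReal.tsum_mul_left]
  refine tsum_congr fun f => ?_
  simp [Fin.consEquiv, Fin.prod_univ_succ, mul_assoc]

lemma geomExp_mono {n : ℕ} {F G : (Fin n → ℕ) → ℝ≥0∞} (h : ∀ f, F f ≤ G f) :
    geomExp n F ≤ geomExp n G :=
  ENNReal.tsum_le_tsum fun f => mul_le_mul_right (h f) _

lemma geomExp_add {n : ℕ} (F G : (Fin n → ℕ) → ℝ≥0∞) :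
    geomExp n (fun f => F f + G f) = geomExp n F + geomExp n G := by
  simp only [geomExp, mul_add, ENNReal.tsum_add]

lemma geomExp_const_mul {n : ℕ} (a : ℝ≥0∞) (F : (Fin n → ℕ) → ℝ≥0∞) :
    geomExp n (fun f => a * F f) = a * geomExp n F := by
  simp only [geomExp, ← ENNReal.tsum_mul_left, mul_left_comm]

lemma geomExp_sum {n : ℕ} {ι : Type*} (s : Finset ι) (F : ι → (Fin n → ℕ) → ℝ≥0∞) :
    geomExp n (fun f => ∑ i ∈ s, F i f) = ∑ i ∈ s, geomExp n (F i) := by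
  simp only [geomExp, Finset.mul_sum]
  exact Summable.tsum_finsetSum fun _ _ => ENNReal.summable

lemma geomExp_comp_rev {n : ℕ} (F : (Fin n → ℕ) → ℝ≥0∞) :
    geomExp n (fun f => F (f ∘ Fin.rev)) = geomExp n F := by
  simp only [geomExp]
  rw [← (Fin.revPerm.arrowCongr (Equiv.refl ℕ)).tsum_eq]
  refine tsum_congr fun f => ?_
  congr 1
  · exact Equiv.prod_comp Fin.revPerm (fun j => (1 / 2 : ℝ≥0∞) ^ (f j + 1))
  · congr 1
    ext j
    simp [Equiv.arrowCongr]

lemma tsum_half_pow : ∑' x : ℕ, (1 / 2 : ℝ≥0∞) ^ (x + 1) = 1 := by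
  simp only [one_div]
  rw [ENNReal.tsum_geometric_add_one, ENNReal.one_sub_inv_two, inv_inv,
    ENNReal.inv_mul_cancel (by simp) (by simp)]

lemma geomExp_const {n : ℕ} (a : ℝ≥0∞) : geomExp n (fun _ => a) = a := by
  induction n with
  | zero => exact geomExp_zero _
  | succ n ih => simp only [geomExp_succ, ih, ENNReal.tsum_mul_right, tsum_half_pow, one_mul]

lemma tsum_tail (M : ℕ) :
    ∑' x : ℕ, (1 / 2 : ℝ≥0∞) ^ (x + 1) * (if M ≤ x then 1 else 0) = 2⁻¹ ^ M := by
  induction M with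
  | zero => simpa using tsum_half_pow
  | succ M ih =>
    rw [tsum_eq_zero_add' ENNReal.summable]
    simp only [add_le_add_iff_right, pow_succ _ (_ + 1), mul_right_comm _ (1 / 2 : ℝ≥0∞)]
    rw [ENNReal.tsum_mul_right, ih]
    simp [pow_succ]

lemma geomExp_sum_tail (n M : ℕ) :
    geomExp n (fun f => ∑ j, if M ≤ f j then 1 else 0) = n * 2⁻¹ ^ M := by
  induction n with
  | zero => simp [geomExp_zero]
  | succ n ih =>
    rw [geomExp_succ]
    simp only [Fin.sum_univ_succ, Fin.cons_zero, Fin.cons_succ, geomExp_add, geomExp_const, ih,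
      mul_add, ENNReal.tsum_add, tsum_tail, ENNReal.tsum_mul_right, tsum_half_pow]
    push_cast
    ring

lemma tsum_potential_step (m : ℕ) :
    ∑' x : ℕ, (1 / 2 : ℝ≥0∞) ^ (x + 1) * (if m ≤ x then 3 / 2 * 2⁻¹ ^ x else 2⁻¹ ^ m) =
      2⁻¹ ^ m := by
  induction m with
  | zero =>
    have h (x : ℕ) : (1 / 2 : ℝ≥0∞) ^ (x + 1) * (3 / 2 * 2⁻¹ ^ x) = 3 / 4 * 4⁻¹ ^ x := by
      have e : (4⁻¹ : ℝ≥0∞) = 2⁻¹ * 2⁻¹ := by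
        rw [← ENNReal.mul_inv (by simp) (by simp)]; norm_num
      rw [div_eq_mul_inv, div_eq_mul_inv, div_eq_mul_inv, e, mul_pow]
      ring
    simp only [Nat.zero_le, if_true, h]
    rw [ENNReal.tsum_mul_left, ENNReal.tsum_geometric]
    have e : (1 - 4⁻¹ : ℝ≥0∞) = 3 / 4 := by
      refine ENNReal.sub_eq_of_eq_add (by simp) ?_
      rw [← one_div, ENNReal.div_add_div_same]
      norm_num
      exact (ENNReal.div_self (by simp) (by simp)).symm
    rw [e, ENNReal.mul_inv_cancel] <;> simp [ENNReal.div_eq_top]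
  | succ m ih =>
    rw [tsum_eq_zero_add' ENNReal.summable]
    have h (x : ℕ) : (1 / 2 : ℝ≥0∞) ^ (x + 1 + 1) *
        (if m + 1 ≤ x + 1 then 3 / 2 * 2⁻¹ ^ (x + 1) else 2⁻¹ ^ (m + 1)) =
        (2⁻¹ * 2⁻¹) * ((1 / 2 : ℝ≥0∞) ^ (x + 1) *
          (if m ≤ x then 3 / 2 * 2⁻¹ ^ x else 2⁻¹ ^ m)) := by
      simp only [add_le_add_iff_right, one_div]
      split_ifs <;> ring
    simp only [h, ENNReal.tsum_mul_left, ih]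
    have h2 : (2⁻¹ : ℝ≥0∞) + 2⁻¹ = 1 := ENNReal.inv_two_add_inv_two
    rw [if_neg (Nat.not_succ_le_zero m)]
    calc _ = (2⁻¹ + 2⁻¹) * ((2⁻¹ : ℝ≥0∞) * 2⁻¹ ^ m) := by
          rw [zero_add, pow_one, one_div]; ring
      _ = _ := by rw [h2, one_mul, pow_succ']

lemma geomExp_recordPotential_le (n m : ℕ) (p : Fin n → Bool) :
    geomExp n (fun f => recordPotential m (((List.finRange n).filter p).map f)) ≤ 2⁻¹ ^ m := by
  induction n generalizing m with
  | zero => simp [geomExp_zero, recordPotential]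
  | succ n ih =>
    rw [geomExp_succ]
    have key (x : ℕ) (f : Fin n → ℕ) :
        ((List.finRange (n + 1)).filter p).map (Fin.cons x f : Fin (n + 1) → ℕ) =
        (if p 0 then [x] else []) ++ ((List.finRange n).filter (p ∘ Fin.succ)).map f := by
      rw [List.finRange_succ, List.filter_cons, List.filter_map]
      split_ifs <;> simp [Function.comp_def]
    simp only [key]
    by_cases hp : p 0
    · simp only [hp, if_true, List.singleton_append, recordPotential]
      rw [← tsum_potential_step m]
      refine ENNReal.tsum_le_tsum fun x => mul_le_mul_right ?_ _
      split_ifs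
      · rw [geomExp_const_mul]
        exact mul_le_mul_right (ih x _) _
      · exact ih m _
    · simp only [hp, Bool.false_eq_true, if_false, List.nil_append, ENNReal.tsum_mul_right,
        tsum_half_pow, one_mul]
      exact ih m _

lemma geomExp_recordPotential_reverse_le (n m : ℕ) (p : Fin n → Bool) :
    geomExp n (fun f => recordPotential m (((List.finRange n).reverse.filter p).map f)) ≤
      2⁻¹ ^ m := by
  refine le_trans (le_of_eq ?_) (geomExp_recordPotential_le n m (p ∘ Fin.rev))
  rw [← geomExp_comp_rev]
  simp only [List.finRange_reverse, List.filter_map, List.map_map, Function.comp_assoc]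
  simp [Function.comp_def]

lemma one_le_pow_mul_recordPotential {N : ℕ} {l : List ℕ} (hk : 14 * N ≤ recordCount 0 l)
    (hl : ∀ y ∈ l, y ≤ 3 * N) :
    1 ≤ 2⁻¹ ^ (4 * N) * recordPotential 0 l := by
  have h2 : (2 : ℝ≥0∞) * 2⁻¹ = 1 := ENNReal.mul_inv_cancel (by simp) (by simp)
  have h32 : (2 : ℝ≥0∞) ≤ (3 / 2) ^ 2 := by
    rw [← ENNReal.toReal_le_toReal (by simp) (by simp [ENNReal.div_eq_top])]
    norm_num
  have h1 : (1 : ℝ≥0∞) ≤ 3 / 2 := by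
    rw [← ENNReal.toReal_le_toReal (by simp) (by simp [ENNReal.div_eq_top])]
    norm_num
  calc (1 : ℝ≥0∞) = 2⁻¹ ^ (4 * N) * (2 ^ (7 * N) * 2⁻¹ ^ (3 * N)) := by
        rw [mul_left_comm, ← pow_add, ← add_mul, ← mul_pow, h2, one_pow]
    _ ≤ 2⁻¹ ^ (4 * N) * (((3 / 2) ^ 2) ^ (7 * N) * 2⁻¹ ^ (3 * N)) := by gcongr
    _ ≤ 2⁻¹ ^ (4 * N) * ((3 / 2) ^ recordCount 0 l * 2⁻¹ ^ (3 * N)) := by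
        rw [← pow_mul]
        gcongr _ * (?_ * _)
        exact pow_le_pow_right₀ h1 (by omega)
    _ ≤ 2⁻¹ ^ (4 * N) * recordPotential 0 l := by
        gcongr
        exact le_recordPotential (3 * N) 0 l (Nat.zero_le _) hl

lemma geomExp_depth_tail_le {n N : ℕ} (hN : 1 ≤ N) (hn : n ≤ 2 ^ N)
    (T : (Fin n → ℕ) → ZTree ℕ)
    (hT : ∀ f : Fin n → ℕ, (T f).isZipTree ∧
      (T f).nodes.Perm ((List.finRange n).map fun j : Fin n => ((j : ℕ), f j))) :
    geomExp n ({f | ∃ i : Fin n, 28 * N < (T f).depth (i : ℕ)}.indicator 1) ≤ 2⁻¹ ^ N := by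
  let right (i : Fin n) (f : Fin n → ℕ) : List ℕ :=
    ((List.finRange n).filter (fun j => i ≤ j)).map f
  let left (i : Fin n) (f : Fin n → ℕ) : List ℕ :=
    ((List.finRange n).reverse.filter (fun j => j ≤ i)).map f
  have hdepth (f : Fin n → ℕ) (i : Fin n) :
      (T f).depth (i : ℕ) ≤ recordCount 0 (right i f) + recordCount 0 (left i f) := by
    refine (depth_le_recordCount (hT f).1 (i : ℕ)).trans (le_of_eq ?_)
    rw [(hT f).1.1.nodes_eq f (hT f).2]
    simp [right, left, List.filter_map, Function.comp_def, ← List.map_reverse]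
  have hpt (f : Fin n → ℕ) :
      {f | ∃ i : Fin n, 28 * N < (T f).depth (i : ℕ)}.indicator (1 : (Fin n → ℕ) → ℝ≥0∞) f ≤
        (∑ j, if 3 * N ≤ f j then 1 else 0) +
          ∑ i : Fin n, 2⁻¹ ^ (4 * N) *
            (recordPotential 0 (right i f) + recordPotential 0 (left i f)) := by
    by_cases hf : f ∈ {f | ∃ i : Fin n, 28 * N < (T f).depth (i : ℕ)}
    swap
    · simp [Set.indicator_of_notMem hf]
    rw [Set.indicator_of_mem hf, Pi.one_apply]
    obtain ⟨i, hi⟩ := hf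
    by_cases hM : ∃ j, 3 * N ≤ f j
    · obtain ⟨j, hj⟩ := hM
      refine le_add_right ?_
      refine le_trans ?_ (Finset.single_le_sum (fun _ _ => zero_le) (Finset.mem_univ j))
      simp [hj]
    · push Not at hM
      refine le_add_left ?_
      refine le_trans ?_ (Finset.single_le_sum (fun _ _ => zero_le) (Finset.mem_univ i))
      rw [mul_add]
      have hd := hdepth f i
      have hle (l : List (Fin n)) : ∀ y ∈ l.map f, y ≤ 3 * N := by
        intro y hy
        obtain ⟨j, -, rfl⟩ := List.mem_map.1 hy
        exact (hM j).le
      rcases le_or_gt (14 * N) (recordCount 0 (right i f)) with h | h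
      · exact le_add_right (one_le_pow_mul_recordPotential h (hle _))
      · exact le_add_left (one_le_pow_mul_recordPotential (by omega) (hle _))
  have hn' : (n : ℝ≥0∞) ≤ 2 ^ N := by exact_mod_cast hn
  have h2 : (2 : ℝ≥0∞) * 2⁻¹ = 1 := ENNReal.mul_inv_cancel (by simp) (by simp)
  calc _ ≤ _ := geomExp_mono hpt
    _ = n * 2⁻¹ ^ (3 * N) + ∑ i : Fin n, 2⁻¹ ^ (4 * N) *
          (geomExp n (fun f => recordPotential 0 (right i f)) +
            geomExp n (fun f => recordPotential 0 (left i f))) := by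
        rw [geomExp_add, geomExp_sum_tail]
        simp only [geomExp_add, geomExp_sum, geomExp_const_mul]
    _ ≤ n * 2⁻¹ ^ (3 * N) + ∑ i : Fin n, 2⁻¹ ^ (4 * N) * (2⁻¹ ^ 0 + 2⁻¹ ^ 0) := by
        gcongr with i
        · exact geomExp_recordPotential_le n 0 _
        · exact geomExp_recordPotential_reverse_le n 0 _
    _ = n * (2⁻¹ ^ (3 * N) + 2 * 2⁻¹ ^ (4 * N)) := by
        simp only [pow_zero, Finset.sum_const, Finset.card_univ, Fintype.card_fin, nsmul_eq_mul,
          one_add_one_eq_two]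
        ring
    _ ≤ 2 ^ N * (2⁻¹ ^ (2 * N + 1) + 2 * 2⁻¹ ^ (2 * N + 2)) := by
        gcongr ?_ * (?_ + 2 * ?_)
        · exact pow_le_pow_of_le_one (by simp) (by simp) (by omega)
        · exact pow_le_pow_of_le_one (by simp) (by simp) (by omega)
    _ = (2 * 2⁻¹) ^ N * 2⁻¹ ^ N * (2⁻¹ + (2 * 2⁻¹) * 2⁻¹) := by ring
    _ = 2⁻¹ ^ N := by rw [h2, one_pow, one_mul, one_mul, ENNReal.inv_two_add_inv_two, mul_one]

end ZTree

/-- **Depth with high probability (Theorem 2, high-probability part).** There is a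
constant `a > 0`, independent of `n` and `c`, such that for every `n ≥ 2` and every
real `c ≥ 1`: if `r : Fin n → ℕ` are independent geometric random variables with
`P(r i = k) = 1/2^(k+1)` (modelled by the product PMF `μ`) and `T r` is the (unique)
zip tree on nodes with keys `0, …, n−1` and ranks `r`, then the probability that some
node of `T r` has depth exceeding `a·c·lg n` is at most `1/n^c`. -/
theorem depth_high_prob :
    ∃ a : ℝ, 0 < a ∧
      ∀ (n : ℕ), 2 ≤ n → ∀ (c : ℝ), 1 ≤ c →
      ∀ (μ : PMF (Fin n → ℕ)),
        (∀ f : Fin n → ℕ, μ f = ∏ j : Fin n, (1 / 2 : ℝ≥0∞) ^ (f j + 1)) →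
      ∀ (T : (Fin n → ℕ) → ZTree ℕ),
        (∀ f : Fin n → ℕ, (T f).isZipTree ∧
            (T f).nodes.Perm ((List.finRange n).map fun j : Fin n => ((j : ℕ), f j))) →
        μ.toOuterMeasure {f : Fin n → ℕ |
            ∃ i : Fin n, a * c * Real.logb 2 n < (((T f).depth (i : ℕ) : ℕ) : ℝ)} ≤
          ENNReal.ofReal (1 / (n : ℝ) ^ c) := by
  refine ⟨56, by norm_num, fun n hn c hc μ hμ T hT => ?_⟩
  have hn2 : (2 : ℝ) ≤ n := by exact_mod_cast hn
  have hn0 : (0 : ℝ) < n := by linarith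
  have hlg : 1 ≤ Real.logb 2 n := by
    rw [Real.le_logb_iff_rpow_le (by norm_num) hn0]
    simpa using hn2
  set t : ℝ := Real.logb 2 n
  have hnt : (n : ℝ) = 2 ^ t := (Real.rpow_logb (by norm_num) (by norm_num) hn0).symm
  have hct : t ≤ c * t := le_mul_of_one_le_left (by linarith) hc
  set N : ℕ := ⌈c * t⌉₊
  have hN1 : c * t ≤ N := Nat.le_ceil _
  have hN2 : (N : ℝ) < c * t + 1 := Nat.ceil_lt_add_one (by linarith)
  have hN : 1 ≤ N := by
    have : (1 : ℝ) ≤ N := by linarith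
    exact_mod_cast this
  have hnN : n ≤ 2 ^ N := by
    have : (n : ℝ) ≤ 2 ^ (N : ℝ) := by
      rw [hnt]
      exact Real.rpow_le_rpow_of_exponent_le (by norm_num) (by linarith)
    rw [Real.rpow_natCast] at this
    exact_mod_cast this
  calc _ ≤ μ.toOuterMeasure {f | ∃ i : Fin n, 28 * N < (T f).depth (i : ℕ)} := by
        refine μ.toOuterMeasure.mono ?_
        rintro f ⟨i, hi⟩
        refine ⟨i, ?_⟩
        have : ((28 * N : ℕ) : ℝ) < (T f).depth (i : ℕ) := by
          push_cast
          linarith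
        exact_mod_cast this
    _ = ZTree.geomExp n
          ({f | ∃ i : Fin n, 28 * N < (T f).depth (i : ℕ)}.indicator 1) := by
        rw [PMF.toOuterMeasure_apply, ZTree.geomExp]
        refine tsum_congr fun f => ?_
        rw [← hμ f, ← Set.indicator_mul_right]
        simp
    _ ≤ 2⁻¹ ^ N := ZTree.geomExp_depth_tail_le hN hnN T hT
    _ = ENNReal.ofReal (2⁻¹ ^ N) := by
        rw [ENNReal.ofReal_pow (by norm_num), ENNReal.ofReal_inv_of_pos (by norm_num)]
        simp
    _ ≤ ENNReal.ofReal (1 / (n : ℝ) ^ c) := by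
        refine ENNReal.ofReal_le_ofReal ?_
        rw [inv_pow, one_div, hnt, ← Real.rpow_mul (by norm_num), ← Real.rpow_natCast]
        gcongr
        · norm_num
        · linarith
end

section
/- Let X_1, …, X_m be independent random variables, each geometrically distributed with P(X_j = t) = 1/2^{t+1}, and let k ∈ ℕ. The expected number of indices j such that X_j ≤ k and X_j > X_z for all z with 1 ≤ z < j is at most (k+1)/2. -/
open scoped ENNReal

lemma tsum_pi_fin_succ {m : ℕ} (f : (Fin (m + 1) → ℕ) → ℝ≥0∞) :
    ∑' X, f X = ∑' a : ℕ, ∑' Y : Fin m → ℕ, f (Fin.cons a Y) := by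
  rw [← (Fin.consEquiv fun _ : Fin (m + 1) => ℕ).tsum_eq f, ENNReal.tsum_prod']
  rfl

lemma sum_geometric_half_add (t : ℕ) :
    ∑ a ∈ Finset.range t, (1 / 2 : ℝ≥0∞) ^ (a + 1) + (1 / 2) ^ t = 1 := by
  induction t with
  | zero => simp
  | succ t ih =>
    rw [Finset.sum_range_succ, add_assoc, ← two_mul, pow_succ', ← mul_assoc, one_div,
      ENNReal.mul_inv_cancel two_ne_zero ENNReal.ofNat_ne_top, one_mul, ← one_div, ih]

lemma tsum_geometric_half : ∑' a : ℕ, (1 / 2 : ℝ≥0∞) ^ (a + 1) = 1 := by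
  rw [ENNReal.tsum_geometric_add_one, one_div, ENNReal.one_sub_inv_two, inv_inv,
    ENNReal.inv_mul_cancel two_ne_zero ENNReal.ofNat_ne_top]

lemma tsum_prod_geometric_half (m : ℕ) :
    ∑' X : Fin m → ℕ, ∏ j, (1 / 2 : ℝ≥0∞) ^ (X j + 1) = 1 := by
  induction m with
  | zero => simp
  | succ m ih =>
    simp_rw [tsum_pi_fin_succ, Fin.prod_univ_succ, Fin.cons_zero, Fin.cons_succ,
      ENNReal.tsum_mul_left, ih, mul_one, tsum_geometric_half]

/-- The number of strict left-to-right maxima of `X` with value `t`. -/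
def recordCount {m : ℕ} (X : Fin m → ℕ) (t : ℕ) : ℕ :=
  ∑ j, if X j = t ∧ ∀ z, z < j → X z < t then 1 else 0

lemma recordCount_cons {m : ℕ} (a : ℕ) (Y : Fin m → ℕ) (t : ℕ) :
    recordCount (Fin.cons a Y : Fin (m + 1) → ℕ) t =
      (if a = t then 1 else 0) + if a < t then recordCount Y t else 0 := by
  unfold recordCount
  rw [Fin.sum_univ_succ]
  by_cases h : a < t <;> simp [Fin.forall_fin_succ, h]

lemma tsum_mul_recordCount_le (m t : ℕ) :
    ∑' X : Fin m → ℕ, (∏ j, (1 / 2 : ℝ≥0∞) ^ (X j + 1)) * (recordCount X t : ℝ≥0∞) ≤ 1 / 2 := by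
  induction m with
  | zero => simp [recordCount]
  | succ m ih =>
    have key (a : ℕ) : ∑' Y : Fin m → ℕ, (∏ j, (1 / 2 : ℝ≥0∞) ^
          ((Fin.cons a Y : Fin (m + 1) → ℕ) j + 1)) *
          (recordCount (Fin.cons a Y : Fin (m + 1) → ℕ) t : ℝ≥0∞) ≤
        (if a = t then (1 / 2) ^ (t + 1) else 0) +
          if a ∈ Finset.range t then (1 / 2) ^ (a + 1) * (1 / 2) else 0 := by
      simp_rw [recordCount_cons, Fin.prod_univ_succ, Fin.cons_zero, Fin.cons_succ, mul_assoc,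
        ENNReal.tsum_mul_left, Finset.mem_range]
      rcases lt_trichotomy a t with h | rfl | h
      · simp only [h, h.ne, if_true, if_false, zero_add]
        gcongr
      · simp [-one_div, tsum_prod_geometric_half]
      · simp [h.ne', h.not_gt]
    rw [tsum_pi_fin_succ]
    refine (ENNReal.tsum_le_tsum key).trans_eq ?_
    rw [ENNReal.tsum_add, tsum_ite_eq,
      tsum_eq_sum (s := Finset.range t) fun a ha => if_neg ha,
      Finset.sum_congr rfl fun a ha => if_pos ha, ← Finset.sum_mul, pow_succ, ← add_mul, add_comm,
      sum_geometric_half_add, one_mul]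

lemma card_records_eq_sum_recordCount {m : ℕ} (X : Fin m → ℕ) (k : ℕ) :
    Nat.card {j : Fin m // X j ≤ k ∧ ∀ z : Fin m, z < j → X z < X j} =
      ∑ t ∈ Finset.range (k + 1), recordCount X t := by
  classical
  unfold recordCount
  rw [Finset.sum_comm, Nat.card_eq_fintype_card, Fintype.card_subtype, Finset.card_filter]
  refine Finset.sum_congr rfl fun j _ => ?_
  simp_rw [ite_and, Finset.sum_ite_eq, Finset.mem_range, Nat.lt_succ_iff]

/-- **Expected length of the zipped path `Q`.** Let `X_1, …, X_m` be independent
geometric random variables with `P(X_j = t) = 1/2^(t+1)` (modelled by the product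
PMF `μ` on `Fin m → ℕ`), and let `k ∈ ℕ`. The expected number of indices `j` such
that `X j ≤ k` and `X j > X z` for all `z < j` is at most `(k+1)/2`. -/
theorem expected_Q_path_length (m k : ℕ)
    (μ : PMF (Fin m → ℕ))
    (hμ : ∀ X : Fin m → ℕ, μ X = ∏ j : Fin m, (1 / 2 : ℝ≥0∞) ^ (X j + 1)) :
    ∑' X : Fin m → ℕ,
        μ X * ((Nat.card {j : Fin m // X j ≤ k ∧
            ∀ z : Fin m, z < j → X z < X j} : ℕ) : ℝ≥0∞) ≤
      ENNReal.ofReal (((k : ℝ) + 1) / 2) := by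
  simp_rw [hμ, card_records_eq_sum_recordCount, Nat.cast_sum, Finset.mul_sum]
  rw [Summable.tsum_finsetSum fun _ _ => ENNReal.summable]
  refine (Finset.sum_le_sum fun t _ => tsum_mul_recordCount_le m t).trans_eq ?_
  rw [Finset.sum_const, Finset.card_range, nsmul_eq_mul, ENNReal.ofReal_div_of_pos two_pos,
    ← Nat.cast_succ, ENNReal.ofReal_natCast, ENNReal.ofReal_ofNat, mul_one_div]
end
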